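/- Let K be a field, and in the Laurent polynomial ring localization, set x = (w-1)/(v-1) and define x_{α,n} = v^α w^{⌈αu⌉} x^n for α ∈ ℤ, n ≥ 0, where u is a rational number with -1 < u < 0. Then the elements x_{α,n} (α ∈ ℤ, n ∈ ℕ₀) are linearly independent over K. -/

import Mathlib

theorem x_linear_independent (K : Type*) [Field K] (u : ℚ) (hu1 : -1 < u) (hu2 : u < 0) :
    let F := FractionRing (MvPolynomial (Fin 2) K)
    let v : F := algebraMap (MvPolynomial (Fin 2) K) F (MvPolynomial.X 0)
    let w : F := algebraMap (MvPolynomial (Fin 2) K) F (MvPolynomial.X 1)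
    let x : F := (w - 1) / (v - 1)
    LinearIndependent K (fun p : ℤ × ℕ => v ^ p.1 * w ^ ⌈(p.1 : ℚ) * u⌉ * x ^ p.2) := by
  intro F v w x
  have hinj : Function.Injective (algebraMap (MvPolynomial (Fin 2) K) F) :=
    IsFractionRing.injective _ _
  have hv : v ≠ 0 := by
    intro h
    exact MvPolynomial.X_ne_zero (R := K) (0 : Fin 2) (hinj (by rw [map_zero]; exact h))
  have hw : w ≠ 0 := by
    intro h
    exact MvPolynomial.X_ne_zero (R := K) (1 : Fin 2) (hinj (by rw [map_zero]; exact h))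
  have hX : ∀ i : Fin 2, (MvPolynomial.X i : MvPolynomial (Fin 2) K) ≠ 1 := by
    intro i h
    have := congrArg (MvPolynomial.eval (fun _ => (0 : K))) h
    simp at this
  have hv1 : v - 1 ≠ 0 := by
    intro h
    exact hX 0 (hinj (by rw [map_one]; exact sub_eq_zero.mp h))
  have hw1 : w - 1 ≠ 0 := by
    intro h
    exact hX 1 (hinj (by rw [map_one]; exact sub_eq_zero.mp h))
  rw [linearIndependent_iff']
  intro s g hs
  generalize hb : (fun a : ℤ => ⌈(a : ℚ) * u⌉) = b at *
  have hs' : ∑ i ∈ s, g i • (v ^ i.1 * w ^ (b i.1) * x ^ i.2) = 0 := by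
    rw [← hb]; exact hs
  obtain ⟨A, hA⟩ : ∃ A : ℤ, ∀ i ∈ s, 0 ≤ i.1 + A :=
    ⟨∑ i ∈ s, |i.1|, fun i hi => by
      have h1 := Finset.single_le_sum (f := fun i : ℤ × ℕ => |i.1|) (fun j _ => abs_nonneg _) hi
      have h2 := neg_abs_le i.1
      linarith⟩
  obtain ⟨B, hB⟩ : ∃ B : ℤ, ∀ i ∈ s, 0 ≤ b i.1 + B :=
    ⟨∑ i ∈ s, |b i.1|, fun i hi => by
      have h1 := Finset.single_le_sum (f := fun i : ℤ × ℕ => |b i.1|) (fun j _ => abs_nonneg _) hi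
      have h2 := neg_abs_le (b i.1)
      linarith⟩
  obtain ⟨N, hN⟩ : ∃ N : ℕ, ∀ i ∈ s, i.2 ≤ N :=
    ⟨∑ i ∈ s, i.2, fun i hi =>
      Finset.single_le_sum (f := fun i : ℤ × ℕ => i.2) (fun j _ => Nat.zero_le _) hi⟩
  have key : ∀ n : ℕ, ∀ i ∈ s, i.2 = n → g i = 0 := by
    intro n
    induction n using Nat.strong_induction_on with
    | _ n ih =>
    let P : MvPolynomial (Fin 2) K := ∑ i ∈ s, g i • (MvPolynomial.X 0 ^ (i.1 + A).toNat *
      MvPolynomial.X 1 ^ (b i.1 + B).toNat * (MvPolynomial.X 1 - 1) ^ (i.2 - n) *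
      (MvPolynomial.X 0 - 1) ^ (N + n - i.2))
    have hmap : algebraMap (MvPolynomial (Fin 2) K) F P =
        (v ^ A * w ^ B * (v - 1) ^ (N + n) / (w - 1) ^ n) *
          ∑ i ∈ s, g i • (v ^ i.1 * w ^ (b i.1) * x ^ i.2) := by
      rw [Finset.mul_sum, map_sum]
      refine Finset.sum_congr rfl fun i hi => ?_
      by_cases hin : i.2 < n
      · rw [ih i.2 hin i hi rfl]; simp
      · push Not at hin
        have hsm : ∀ (c : K) (q : MvPolynomial (Fin 2) K),
            algebraMap (MvPolynomial (Fin 2) K) F (c • q) = c • algebraMap _ F q :=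
          fun c q => map_smul (IsScalarTower.toAlgHom K (MvPolynomial (Fin 2) K) F) c q
        rw [hsm, mul_smul_comm]
        congr 1
        simp only [map_mul, map_pow, map_sub, map_one]
        change v ^ _ * w ^ _ * (w - 1) ^ _ * (v - 1) ^ _ = _
        have e1 : v ^ (i.1 + A).toNat = v ^ i.1 * v ^ A := by
          rw [← zpow_add₀ hv, ← zpow_natCast, Int.toNat_of_nonneg (hA i hi)]
        have e2 : w ^ (b i.1 + B).toNat = w ^ b i.1 * w ^ B := by
          rw [← zpow_add₀ hw, ← zpow_natCast, Int.toNat_of_nonneg (hB i hi)]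
        rw [e1, e2, pow_sub₀ _ hw1 hin,
          pow_sub₀ _ hv1 (le_trans (hN i hi) (Nat.le_add_right _ _))]
        simp only [x, div_pow]
        simp only [div_eq_mul_inv]
        ring
    have hP : P = 0 := hinj (by rw [hmap, hs', mul_zero, map_zero])
    have hev : (∑ i ∈ s, if i.2 = n then Polynomial.monomial (i.1 + A).toNat (g i) else 0) *
        (Polynomial.X - 1 : Polynomial K) ^ N = 0 := by
      have h := congrArg (MvPolynomial.aeval ![(Polynomial.X : Polynomial K), 1]) hP
      rw [map_zero, map_sum] at h
      refine Eq.trans ?_ h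
      rw [Finset.sum_mul]
      refine Finset.sum_congr rfl fun i hi => ?_
      simp only [map_smul, map_mul, map_pow, map_sub, map_one, MvPolynomial.aeval_X,
        Matrix.cons_val_zero, Matrix.cons_val_one, sub_self, one_pow, mul_one]
      rcases lt_trichotomy i.2 n with hlt | heq | hgt
      · rw [ih i.2 hlt i hi rfl]; simp
      · rw [if_pos heq, heq]
        simp [Polynomial.smul_eq_C_mul, ← Polynomial.C_mul_X_pow_eq_monomial, mul_assoc]
      · rw [if_neg hgt.ne', zero_pow (by omega)]; simp
    have hX1 : (Polynomial.X - 1 : Polynomial K) ^ N ≠ 0 :=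
      pow_ne_zero _ (by simpa using Polynomial.X_sub_C_ne_zero (1 : K))
    have hQ := (mul_eq_zero.mp hev).resolve_right hX1
    intro i hi hin
    have hc := congrArg (fun q => Polynomial.coeff q (i.1 + A).toNat) hQ
    simp only [Polynomial.finsetSum_coeff, Polynomial.coeff_zero] at hc
    rw [Finset.sum_eq_single i] at hc
    · simpa [hin] using hc
    · intro j hj hji
      split_ifs with hjn
      · rw [Polynomial.coeff_monomial, if_neg]
        intro h
        apply hji
        have h1 := hA i hi
        have h2 := hA j hj
        exact Prod.ext (by omega) (by omega)
      · simp
    · intro h; exact absurd hi h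
  exact fun i hi => key i.2 i hi rfl
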